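/- For n ≥ 5, if (λ,μ) is a bipartition of n and the simple ℂ[B_n]-module S^{(λ,μ)} has dimension different from 1, then dim(S^{(λ,μ)}) ≥ n − 1. -/

import Mathlib

open Module

lemma relC {ι V : Type*} [Fintype ι] [DecidableEq ι] [AddCommGroup V] [Module ℂ V]
    (x : ι → V) (j k : ι) (hjk : j ≠ k) (L : V →ₗ[ℂ] V)
    (hL : ∀ i, L (x i) = x (Equiv.swap j k i)) (c : ι → ℂ) (y : V) (hy : L y = y)
    (h : ∑ i, c i • x i = y) : (c j - c k) • (x j - x k) = 0 := by
  have h2 : ∑ i, c (Equiv.swap j k i) • x i = y := by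
    rw [← hy, ← h, map_sum, ← Equiv.sum_comp (Equiv.swap j k)]
    refine Finset.sum_congr rfl fun i _ => ?_
    simp [hL]
  have h3 : ∑ i, (c i - c (Equiv.swap j k i)) • x i = 0 := by
    simp only [sub_smul, Finset.sum_sub_distrib, h, h2, sub_self]
  rw [← Finset.sum_subset (Finset.subset_univ {j, k})] at h3
  · rw [Finset.sum_pair hjk] at h3
    simp only [Equiv.swap_apply_left, Equiv.swap_apply_right] at h3
    rw [← h3]; module
  · intro i _ hi
    simp only [Finset.mem_insert, Finset.mem_singleton, not_or] at hi
    rw [Equiv.swap_apply_of_ne_of_ne hi.1 hi.2]; simp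

lemma constC {ι V : Type*} [DecidableEq ι] [AddCommGroup V] [Module ℂ V]
    (x : ι → V) (hL : ∀ j k, j ≠ k → ∃ L : V →ₗ[ℂ] V, ∀ i, L (x i) = x (Equiv.swap j k i))
    (a b : ι) (hab : a ≠ b) (h : x a = x b) (m : ι) : x m = x a := by
  by_cases hm : m = a
  · rw [hm]
  by_cases hm' : m = b
  · rw [hm', h]
  obtain ⟨L, hL⟩ := hL b m (Ne.symm hm')
  have h1 := hL a
  have h2 := hL b
  rw [Equiv.swap_apply_of_ne_of_ne hab (Ne.symm hm)] at h1
  rw [Equiv.swap_apply_left] at h2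
  rw [← h1, ← h2, h]

lemma indC {ι V : Type*} [Fintype ι] [DecidableEq ι] [AddCommGroup V] [Module ℂ V]
    (x : ι → V) (hL : ∀ j k, j ≠ k → ∃ L : V →ₗ[ℂ] V, ∀ i, L (x i) = x (Equiv.swap j k i))
    (hx : Function.Injective x) (i0 : ι) :
    LinearIndependent ℂ (fun i : {i // i ≠ i0} => x i) := by
  rw [Fintype.linearIndependent_iff]
  intro g hg
  let c : ι → ℂ := fun i => if h : i ≠ i0 then g ⟨i, h⟩ else 0
  have hc : ∑ i, c i • x i = 0 := by
    rw [← hg]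
    rw [← Fintype.sum_subtype_add_sum_subtype (fun i => i ≠ i0) (fun i => c i • x i)]
    have : ∑ i : {i // ¬ i ≠ i0}, c i • x i = 0 := by
      refine Finset.sum_eq_zero fun i _ => ?_
      simp only [c, dif_neg i.2, zero_smul]
    rw [this, add_zero]
    refine Finset.sum_congr rfl fun i _ => ?_
    simp only [c, dif_pos i.2]
  intro i
  obtain ⟨L, hL⟩ := hL i i0 i.2
  have h1 := relC x i i0 i.2 L hL c 0 (map_zero L) hc
  rcases smul_eq_zero.1 h1 with h | h
  · simpa [c, i.2] using h
  · exact absurd (hx (sub_eq_zero.1 h)) i.2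

lemma fixA {α V : Type*} [Fintype α] [DecidableEq α] [AddCommGroup V] [Module ℂ V]
    [FiniteDimensional ℂ V] (ρ : Equiv.Perm α →* (V →ₗ[ℂ] V))
    (hd : finrank ℂ V + 2 ≤ Fintype.card α) (u : α → V)
    (hu : ∀ σ i, ρ σ (u i) = u (σ i)) (k : α) (hk : u k ≠ 0) :
    ∃ w : V, w ≠ 0 ∧ ∀ σ, ρ σ w = w := by
  have hL : ∀ j k, j ≠ k → ∃ L : V →ₗ[ℂ] V, ∀ i, L (u i) = u (Equiv.swap j k i) :=
    fun j k _ => ⟨ρ (Equiv.swap j k), fun i => hu _ i⟩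
  have hinj : ¬ Function.Injective u := by
    intro hinj
    have h1 := (indC u hL hinj k).fintype_card_le_finrank
    rw [Fintype.card_subtype_compl] at h1
    simp at h1
    omega
  simp only [Function.Injective, not_forall] at hinj
  obtain ⟨a, b, h, hab⟩ := hinj
  have hc := constC u hL a b hab h
  refine ⟨u k, hk, fun σ => ?_⟩
  rw [hu, hc, hc k]

lemma fixPQ {α V : Type*} [Fintype α] [DecidableEq α] [AddCommGroup V] [Module ℂ V]
    (ρ : Equiv.Perm α →* (V →ₗ[ℂ] V)) (p q : α) (v : V)
    (hs : ∀ a b, a ≠ b → a ≠ p → a ≠ q → b ≠ p → b ≠ q → ρ (Equiv.swap a b) v = v)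
    (g : Equiv.Perm α) (hp : g p = p) (hq : g q = q) : ρ g v = v := by
  have key : ∀ t : Equiv.Perm {x // x ≠ p ∧ x ≠ q}, ρ (Equiv.Perm.ofSubtype t) v = v := by
    intro t
    induction t using Equiv.Perm.swap_induction_on with
    | one => simp
    | swap_mul f x y hxy ih =>
      rw [map_mul, map_mul, Module.End.mul_apply, ih, Equiv.Perm.ofSubtype_swap_eq]
      exact hs _ _ (fun h => hxy (Subtype.ext h)) x.2.1 x.2.2 y.2.1 y.2.2
  have h1 : ∀ x, (x ≠ p ∧ x ≠ q) ↔ (g x ≠ p ∧ g x ≠ q) := by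
    intro x
    rw [← hp, ← hq, g.injective.ne_iff, g.injective.ne_iff, hp, hq]
  have h2 := key (g.subtypePerm fun x => (h1 x).symm)
  rwa [Equiv.Perm.ofSubtype_subtypePerm] at h2
  intro x hx
  constructor
  · rintro rfl; exact hx hp
  · rintro rfl; exact hx hq

lemma exF {α V : Type*} [Fintype α] [DecidableEq α] [AddCommGroup V] [Module ℂ V]
    (ρ : Equiv.Perm α →* (V →ₗ[ℂ] V)) (p q : α) (v : V)
    (hg : ∀ g : Equiv.Perm α, g p = p → g q = q → ρ g v = v) :
    ∃ F : α → α → V, F p q = v ∧ (∀ i, p ≠ q → F i i = 0) ∧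
      ∀ (σ : Equiv.Perm α) i j, ρ σ (F i j) = F (σ i) (σ j) := by
  classical
  let F : α → α → V := fun i j =>
    if h : ∃ σ : Equiv.Perm α, σ p = i ∧ σ q = j then ρ h.choose v else 0
  have hF : ∀ σ : Equiv.Perm α, F (σ p) (σ q) = ρ σ v := by
    intro σ
    have h : ∃ τ : Equiv.Perm α, τ p = σ p ∧ τ q = σ q := ⟨σ, rfl, rfl⟩
    simp only [F, dif_pos h]
    have h2 := hg (σ⁻¹ * h.choose) (by simp [h.choose_spec.1]) (by simp [h.choose_spec.2])
    have h3 : ρ σ (ρ (σ⁻¹ * h.choose) v) = ρ σ v := by rw [h2]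
    rwa [← Module.End.mul_apply, ← map_mul, mul_inv_cancel_left] at h3
  refine ⟨F, by simpa using hF 1, ?_, ?_⟩
  · intro i hpq
    refine dif_neg ?_
    rintro ⟨σ, h1, h2⟩
    exact hpq (σ.injective (h1.trans h2.symm))
  · intro σ i j
    by_cases h : ∃ τ : Equiv.Perm α, τ p = i ∧ τ q = j
    · obtain ⟨τ, rfl, rfl⟩ := h
      rw [hF, ← Module.End.mul_apply, ← map_mul, ← Equiv.Perm.mul_apply, ← Equiv.Perm.mul_apply, hF]
    · have h' : ¬ ∃ τ : Equiv.Perm α, τ p = σ i ∧ τ q = σ j := by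
        rintro ⟨τ, h1, h2⟩
        exact h ⟨σ⁻¹ * τ, by simp [h1], by simp [h2]⟩
      simp only [F, dif_neg h, dif_neg h', map_zero]

lemma two_trans {α : Type*} [DecidableEq α] (p q i j : α) (hpq : p ≠ q) (hij : i ≠ j) :
    ∃ σ : Equiv.Perm α, σ p = i ∧ σ q = j := by
  refine ⟨Equiv.swap (Equiv.swap p i q) j * Equiv.swap p i, ?_, by simp⟩
  rw [Equiv.Perm.mul_apply, Equiv.swap_apply_left, Equiv.swap_apply_of_ne_of_ne _ hij]
  intro h
  have : Equiv.swap p i p = Equiv.swap p i q := by simpa using h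
  exact hpq ((Equiv.swap p i).injective this)

lemma mainL {α V : Type*} [Fintype α] [DecidableEq α] [AddCommGroup V] [Module ℂ V]
    [FiniteDimensional ℂ V] (ρ : Equiv.Perm α →* (V →ₗ[ℂ] V)) (hn : 5 ≤ Fintype.card α)
    (hd : finrank ℂ V + 2 ≤ Fintype.card α) (p q : α) (hpq : p ≠ q) (v : V) (hv : v ≠ 0)
    (hs : ∀ a b, a ≠ b → a ≠ p → a ≠ q → b ≠ p → b ≠ q → ρ (Equiv.swap a b) v = v)
    (ε : ℂ) (hε : ρ (Equiv.swap p q) v = ε • v) :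
    ∃ w : V, w ≠ 0 ∧ ∀ σ, ρ σ w = w := by
  obtain ⟨F, hF, hF0, hρ⟩ := exF ρ p q v (fun g => fixPQ ρ p q v hs g)
  replace hF0 := fun i => hF0 i hpq
  have hne : ∀ i j, i ≠ j → F i j ≠ 0 := by
    intro i j hij h0
    obtain ⟨σ, h1, h2⟩ := two_trans i j p q hij hpq
    have := hρ σ i j
    rw [h0, map_zero, h1, h2, hF] at this
    exact hv this.symm
  have hεF : ∀ i j, F j i = ε • F i j := by
    intro i j
    by_cases hij : i = j
    · subst hij; simp [hF0]
    obtain ⟨σ, rfl, rfl⟩ := two_trans p q i j hpq hij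
    have h1 : F q p = ε • F p q := by
      rw [hF, ← hε, ← hF, hρ, Equiv.swap_apply_left, Equiv.swap_apply_right]
    rw [← hρ, ← hρ, h1, map_smul]
  have hε2 : ε * ε = 1 := by
    have h := hεF p q
    rw [hεF q p, smul_smul] at h
    have h2 : (ε * ε - 1) • F q p = 0 := by
      rw [sub_smul, one_smul, ← smul_smul, ← hεF q p, ← hεF p q, sub_self]
    rcases smul_eq_zero.1 h2 with h3 | h3
    · linear_combination h3
    · exact absurd h3 (hne _ _ hpq.symm)
  by_cases hw : ∃ k, ∑ i, F i k ≠ 0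
  · obtain ⟨k, hk⟩ := hw
    refine fixA ρ hd (fun k => ∑ i, F i k) ?_ k hk
    intro σ i
    simp only [map_sum, hρ]
    exact Equiv.sum_comp σ (fun j => F j (σ i))
  push Not at hw
  exfalso
  -- choose two further points
  obtain ⟨k, hk⟩ : ∃ k, k ∉ ({p, q} : Finset α) := by
    by_contra! h
    have := Finset.card_le_card (fun x _ => h x : Finset.univ ⊆ ({p, q} : Finset α))
    have := Finset.card_le_two (a := p) (b := q)
    simp only [Finset.card_univ] at *
    omega
  obtain ⟨r, hr⟩ : ∃ r, r ∉ ({p, q, k} : Finset α) := by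
    by_contra! h
    have := Finset.card_le_card (fun x _ => h x : Finset.univ ⊆ ({p, q, k} : Finset α))
    have := Finset.card_le_three (a := p) (b := q) (c := k)
    simp only [Finset.card_univ] at *
    omega
  simp only [Finset.mem_insert, Finset.mem_singleton, not_or] at hk hr
  obtain ⟨hkp, hkq⟩ := hk
  obtain ⟨hrp, hrq, hrk⟩ := hr
  let x : {i // i ≠ k} → V := fun i => F i k
  have hswap : ∀ j l i : {i // i ≠ k}, ρ (Equiv.swap j.1 l.1) (x i) = x (Equiv.swap j l i) := by
    intro j l i
    simp only [x, hρ]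
    rw [Equiv.swap_apply_of_ne_of_ne (x := k) j.2.symm l.2.symm]
    congr 1
    simp only [Equiv.swap_apply_def, Subtype.ext_iff]
    split_ifs <;> rfl
  have hL : ∀ j l, j ≠ l → ∃ L : V →ₗ[ℂ] V, ∀ i, L (x i) = x (Equiv.swap j l i) :=
    fun j l _ => ⟨ρ (Equiv.swap j.1 l.1), hswap j l⟩
  have hcard : Fintype.card {i // i ≠ k} = Fintype.card α - 1 := by
    rw [Fintype.card_subtype_compl]; simp
  have hsum : ∀ k, ∑ i : {i // i ≠ k}, F i k = 0 := by
    intro k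
    rw [← hw k, ← Fintype.sum_subtype_add_sum_subtype (fun i => i ≠ k) (fun i => F i k)]
    have : ∑ i : {i // ¬ i ≠ k}, F i k = 0 := by
      refine Finset.sum_eq_zero fun i _ => ?_
      rw [not_not.1 i.2, hF0]
    rw [this, add_zero]
  have hinj : Function.Injective x := by
    intro a b h
    by_contra hab
    have hc := constC x hL a b hab h
    have h1 : ∑ i, x i = 0 := hsum k
    rw [Finset.sum_congr rfl (fun i _ => hc i)] at h1
    simp only [Finset.sum_const, Finset.card_univ, hcard, ← Nat.cast_smul_eq_nsmul ℂ] at h1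
    rcases smul_eq_zero.1 h1 with h2 | h2
    · rw [Nat.cast_eq_zero] at h2; omega
    · exact hne _ _ a.2 h2
  let P : {i // i ≠ k} := ⟨p, hkp ∘ Eq.symm⟩
  let Q : {i // i ≠ k} := ⟨q, hkq ∘ Eq.symm⟩
  let R : {i // i ≠ k} := ⟨r, hrk⟩
  have hPQ : P ≠ Q := fun h => hpq (congrArg Subtype.val h)
  have hPR : P ≠ R := fun h => hrp (congrArg Subtype.val h).symm
  have hQR : Q ≠ R := fun h => hrq (congrArg Subtype.val h).symm
  have hind := indC x hL hinj R
  have hcard2 : Fintype.card {i : {i // i ≠ k} // i ≠ R} = Fintype.card α - 2 := by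
    rw [Fintype.card_subtype_compl, hcard]; simp; omega
  have hspan := hind.span_eq_top_of_card_eq_finrank' (by
    have := hind.fintype_card_le_finrank
    omega)
  have hind2 : ∀ a b : ℂ, a • F p k + b • F q k = 0 → a = 0 ∧ b = 0 := by
    have h1 : LinearIndependent ℂ ![x P, x Q] := by
      have := hind.comp ![⟨P, hPR⟩, ⟨Q, hQR⟩] (by
        intro i j
        fin_cases i <;> fin_cases j <;> simp [hPQ, hPQ.symm])
      convert this using 1
      funext i
      fin_cases i <;> rfl
    intro a b h
    exact LinearIndependent.pair_iff.1 h1 a b h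
  have hmem : F p q ∈ Submodule.span ℂ (Set.range fun i : {i // i ≠ R} => x i) := by
    rw [hspan]; trivial
  obtain ⟨g, hg⟩ := (Submodule.mem_span_range_iff_exists_fun ℂ).1 hmem
  obtain ⟨a, b, hab⟩ : ∃ a b : ℂ, F p q = a • F p k + b • F q k := by
    let c : {i // i ≠ k} → ℂ := fun i => if h : i ≠ R then g ⟨i, h⟩ else 0
    have hc : ∑ i, c i • x i = F p q := by
      rw [← hg]
      rw [← Fintype.sum_subtype_add_sum_subtype (fun i => i ≠ R) (fun i => c i • x i)]
      have : ∑ i : {i // ¬ i ≠ R}, c i • x i = 0 := by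
        refine Finset.sum_eq_zero fun i _ => ?_
        simp only [c, dif_neg i.2, zero_smul]
      rw [this, add_zero]
      refine Finset.sum_congr rfl fun i _ => ?_
      simp only [c, dif_pos i.2]
    have hcR : c R = 0 := dif_neg (by simp)
    have hc0 : ∀ i, i ≠ P → i ≠ Q → c i = 0 := by
      intro i hiP hiQ
      by_cases hiR : i = R
      · rw [hiR, hcR]
      have h1 := relC x i R hiR _ (hswap i R) c (F p q) (by
        rw [hρ, Equiv.swap_apply_of_ne_of_ne, Equiv.swap_apply_of_ne_of_ne]
        · exact fun h => hiQ (Subtype.ext h.symm)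
        · exact (Ne.symm hrq)
        · exact fun h => hiP (Subtype.ext h.symm)
        · exact (Ne.symm hrp)) hc
      rcases smul_eq_zero.1 h1 with h | h
      · rw [hcR, sub_zero] at h; exact h
      · exact absurd (hinj (sub_eq_zero.1 h)) hiR
    refine ⟨c P, c Q, ?_⟩
    rw [← hc, ← Finset.sum_subset (Finset.subset_univ {P, Q}), Finset.sum_pair hPQ]
    intro i _ hi
    simp only [Finset.mem_insert, Finset.mem_singleton, not_or] at hi
    rw [hc0 i hi.1 hi.2, zero_smul]
  -- b = ε a
  have h1 : F q p = a • F q k + b • F p k := by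
    have := congrArg (ρ (Equiv.swap p q)) hab
    simp only [map_add, map_smul, hρ, Equiv.swap_apply_left, Equiv.swap_apply_right,
      Equiv.swap_apply_of_ne_of_ne hkp hkq] at this
    exact this
  rw [hεF p q, hab] at h1
  have h2 := hind2 (ε * a - b) (ε * b - a) (by
    have := sub_eq_zero.2 h1
    rw [← this]; module)
  have hb : b = ε * a := by linear_combination -h2.1
  have h3 : F p k = a • F p q + b • F k q := by
    have := congrArg (ρ (Equiv.swap q k)) hab
    simp only [map_add, map_smul, hρ, Equiv.swap_apply_left, Equiv.swap_apply_right,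
      Equiv.swap_apply_of_ne_of_ne hpq (Ne.symm hkp)] at this
    exact this
  rw [hεF q k, hab] at h3
  have h4 := hind2 (a * a - 1) (a * b + b * ε) (by
    have := sub_eq_zero.2 h3.symm
    rw [← this]; module)
  have ha : a = -ε := by
    have h5 : a * (a * ε + 1) = 0 := by
      have := h4.2
      rw [hb] at this
      linear_combination this - a * hε2
    have ha0 : a ≠ 0 := by
      intro h; rw [h] at h4; simpa using h4.1
    have h6 := (mul_eq_zero.1 h5).resolve_left ha0
    linear_combination ε * h6 - a * hε2
  have hb' : b = -1 := by rw [hb, ha]; linear_combination -hε2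
  -- general relation in the first variable
  have h5 : ∀ i, i ≠ q → i ≠ k → F i q = -ε • F i k - F q k := by
    intro i hiq hik
    have h0 : F p q = -ε • F p k - F q k := by rw [hab, ha, hb']; module
    have := congrArg (ρ (Equiv.swap p i)) h0
    simp only [map_sub, map_smul, hρ, Equiv.swap_apply_left,
      Equiv.swap_apply_of_ne_of_ne hpq.symm hiq.symm,
      Equiv.swap_apply_of_ne_of_ne hkp hik.symm] at this
    exact this
  have h6 : ∑ i, (F i q + ε • F i k + F q k) = F k q + F q k + ε • F q k + F q k := by
    rw [← Finset.sum_subset (Finset.subset_univ {k, q}), Finset.sum_pair hkq]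
    · rw [hF0, hF0]; module
    · intro i _ hi
      simp only [Finset.mem_insert, Finset.mem_singleton, not_or] at hi
      rw [h5 i hi.2 hi.1]; module
  rw [Finset.sum_add_distrib, Finset.sum_add_distrib, ← Finset.smul_sum, hw, hw] at h6
  simp only [Finset.sum_const, Finset.card_univ, ← Nat.cast_smul_eq_nsmul ℂ, hεF q k] at h6
  have h7 : ((Fintype.card α : ℂ) - 2 - 2 * ε) • F q k = 0 := by
    have := sub_eq_zero.2 h6
    rw [← this]; module
  have h8 := (smul_eq_zero.1 h7).resolve_right (hne _ _ (Ne.symm hkq))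
  have h9 : ((Fintype.card α : ℂ) - 2) * ((Fintype.card α : ℂ) - 2) = 4 := by
    linear_combination (Fintype.card α - 2 + 2 * ε) * h8 + 4 * hε2
  obtain ⟨m, hm⟩ := Nat.exists_eq_add_of_le hn
  rw [hm] at h9
  have h10 : (((3 + m) * (3 + m) : ℕ) : ℂ) = ((4 : ℕ) : ℂ) := by
    push_cast at h9 ⊢; rw [← h9]; ring
  have h11 := Nat.cast_injective h10
  nlinarith

lemma exSub {G V : Type*} [Group G] [AddCommGroup V] [Module ℂ V] (ρ : G →* (V →ₗ[ℂ] V))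
    (E : Submodule ℂ V) (h : ∀ g, ∀ v ∈ E, ρ g v ∈ E) :
    ∃ ρ' : G →* (E →ₗ[ℂ] E), ∀ g v, ((ρ' g v : E) : V) = ρ g v :=
  ⟨{ toFun := fun g => (ρ g).restrict (h g)
     map_one' := by ext v; simp
     map_mul' := fun a b => by ext v; simp }, fun g v => rfl⟩

lemma matK (A B C S T : Matrix (Fin 2) (Fin 2) ℂ) (hA : A * A = 1) (hAB : A * B = C)
    (hS : S * S = 1) (hT : T * T = 1) (hB : B = S * A * S) (hC : C = T * A * T) : A = 1 := by
  have dS : S.det * S.det = 1 := by rw [← Matrix.det_mul, hS, Matrix.det_one]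
  have dT : T.det * T.det = 1 := by rw [← Matrix.det_mul, hT, Matrix.det_one]
  have dB : B.det = A.det := by
    rw [hB, Matrix.det_mul, Matrix.det_mul]; linear_combination A.det * dS
  have dC : C.det = A.det := by
    rw [hC, Matrix.det_mul, Matrix.det_mul]; linear_combination A.det * dT
  have dA : A.det * A.det = 1 := by rw [← Matrix.det_mul, hA, Matrix.det_one]
  have d1 : A.det = 1 := by
    have := congrArg Matrix.det hAB
    rw [Matrix.det_mul, dB, dC, dA] at this
    exact this.symm
  have hCH := Matrix.aeval_self_charpoly A
  rw [Matrix.charpoly_fin_two, d1] at hCH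
  simp only [map_add, map_sub, map_mul, map_pow, Polynomial.aeval_X, Polynomial.aeval_C, map_one,
    pow_two, hA] at hCH
  rw [← Algebra.smul_def] at hCH
  have h2 : A.trace • A = (2 : ℂ) • (1 : Matrix (Fin 2) (Fin 2) ℂ) := by
    rw [two_smul]
    have : (1 : Matrix (Fin 2) (Fin 2) ℂ) - A.trace • A + 1 = 0 := hCH
    rw [← sub_eq_zero, ← neg_eq_zero, ← this]; abel
  have ht : A.trace ≠ 0 := by
    intro h
    rw [h, zero_smul] at h2
    have := congrFun (congrFun h2 0) 0
    simp at this
  have h3 : A = (A.trace⁻¹ * 2) • (1 : Matrix (Fin 2) (Fin 2) ℂ) := by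
    rw [mul_smul, ← h2, smul_smul, inv_mul_cancel₀ ht, one_smul]
  have hBA : B = A := by
    rw [hB, h3]; simp [hS]
  have hCA : C = A := by
    rw [hC, h3]; simp [hT]
  rw [hBA, hCA, hA] at hAB
  exact hAB.symm

lemma klein4 {E : Type*} [AddCommGroup E] [Module ℂ E] [FiniteDimensional ℂ E]
    (hE : finrank ℂ E = 2) (ρ : Equiv.Perm (Fin 4) →* (E →ₗ[ℂ] E)) :
    ρ (Equiv.swap 0 1 * Equiv.swap 2 3) = 1 := by
  let b := finBasisOfFinrankEq ℂ E hE
  let f := LinearMap.toMatrixAlgEquiv b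
  let M : Equiv.Perm (Fin 4) →* Matrix (Fin 2) (Fin 2) ℂ := (f : _ →* _).comp ρ
  have key : M (Equiv.swap 0 1 * Equiv.swap 2 3) = 1 := by
    apply matK _ (M (Equiv.swap 0 2 * Equiv.swap 1 3)) (M (Equiv.swap 0 3 * Equiv.swap 1 2))
      (M (Equiv.swap 1 2)) (M (Equiv.swap 1 3))
    all_goals simp only [← map_mul]
    · rw [← map_one M]; congr 1; decide
    · congr 1; decide
    · rw [← map_one M]; congr 1; decide
    · rw [← map_one M]; congr 1; decide
    · congr 1; decide
    · congr 1; decide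
  apply f.injective
  rw [map_one]
  exact key

lemma klein {β E : Type*} [Fintype β] [DecidableEq β] [AddCommGroup E] [Module ℂ E]
    [FiniteDimensional ℂ E] (hE : finrank ℂ E = 2) (e : Fin 4 ≃ β)
    (ρ : Equiv.Perm β →* (E →ₗ[ℂ] E)) :
    ρ (Equiv.swap (e 0) (e 1) * Equiv.swap (e 2) (e 3)) = 1 := by
  have h := klein4 hE (ρ.comp (e.permCongrHom : _ →* _))
  rw [← h]
  simp only [MonoidHom.comp_apply]
  congr 1
  ext x
  obtain ⟨y, rfl⟩ := e.surjective x
  simp [Equiv.permCongrHom, ← e.injective.swap_apply]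

lemma conjEq {α V : Type*} [DecidableEq α] [AddCommGroup V] [Module ℂ V]
    (ρ : Equiv.Perm α →* (V →ₗ[ℂ] V)) (p q : α) (hpq : p ≠ q) (c : ℂ)
    (h : ∀ v, ρ (Equiv.swap p q) v = c • v) (a b : α) (hab : a ≠ b) (v : V) :
    ρ (Equiv.swap a b) v = c • v := by
  obtain ⟨σ, rfl, rfl⟩ := two_trans p q a b hpq hab
  rw [Equiv.swap_apply_apply, map_mul, map_mul, Module.End.mul_apply, Module.End.mul_apply, h,
    map_smul, ← Module.End.mul_apply, ← map_mul]
  simp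

lemma dimOne {α V : Type*} [DecidableEq α] [AddCommGroup V] [Module ℂ V]
    (ρ : Equiv.Perm α →* (V →ₗ[ℂ] V)) (hd : finrank ℂ V = 1) :
    ∃ v : V, v ≠ 0 ∧ ∃ ε : ℂ, ∀ a b, a ≠ b → ρ (Equiv.swap a b) v = ε • v := by
  obtain ⟨v, hv, hs⟩ := finrank_eq_one_iff'.1 hd
  refine ⟨v, hv, ?_⟩
  by_cases h : ∃ p q : α, p ≠ q
  · obtain ⟨p, q, hpq⟩ := h
    obtain ⟨c, hc⟩ := hs (ρ (Equiv.swap p q) v)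
    refine ⟨c, fun a b hab => conjEq ρ p q hpq c ?_ a b hab v⟩
    intro w
    obtain ⟨d, rfl⟩ := hs w
    rw [map_smul, ← hc, smul_comm]
  · push Not at h
    exact ⟨1, fun a b hab => absurd (h a b) hab⟩

lemma allEq {α V : Type*} [Fintype α] [DecidableEq α] [AddCommGroup V] [Module ℂ V]
    (ρ : Equiv.Perm α →* (V →ₗ[ℂ] V)) (hn : 5 ≤ Fintype.card α) (p a b c d : α)
    (hab : a ≠ b) (hpa : p ≠ a) (hpb : p ≠ b) (hpc : p ≠ c) (hpd : p ≠ d)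
    (hac : a ≠ c) (had : a ≠ d)
    (h : ρ (Equiv.swap a b * Equiv.swap c d) = 1) (x y : α) (hxy : x ≠ y) :
    ρ (Equiv.swap x y) = ρ (Equiv.swap a b) := by
  have hsq : ∀ x y : α, ρ (Equiv.swap x y) * ρ (Equiv.swap x y) = 1 := by
    intro x y; rw [← map_mul, Equiv.swap_mul_self, map_one]
  have h1 : ρ (Equiv.swap b a) = ρ (Equiv.swap c d) := by
    rw [Equiv.swap_comm b a]
    calc _ = ρ (Equiv.swap a b) * (ρ (Equiv.swap c d) * ρ (Equiv.swap c d)) := by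
          rw [hsq, mul_one]
      _ = _ := by rw [← mul_assoc, ← map_mul, h, one_mul]
  have h2 : ρ (Equiv.swap b p) = ρ (Equiv.swap c d) := by
    have e1 : Equiv.swap b p = Equiv.swap a p * Equiv.swap b a * (Equiv.swap a p)⁻¹ := by
      rw [← Equiv.swap_apply_apply, Equiv.swap_apply_left,
        Equiv.swap_apply_of_ne_of_ne hab.symm hpb.symm]
    have e2 : Equiv.swap c d = Equiv.swap a p * Equiv.swap c d * (Equiv.swap a p)⁻¹ := by
      rw [← Equiv.swap_apply_apply, Equiv.swap_apply_of_ne_of_ne hac.symm hpc.symm,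
        Equiv.swap_apply_of_ne_of_ne had.symm hpd.symm]
    rw [e1, e2]
    simp only [map_mul, h1]
  have h3 : ρ (Equiv.swap b a * Equiv.swap b p) = 1 := by
    rw [map_mul, h1, h2, hsq]
  have h3c := Equiv.Perm.isThreeCycle_swap_mul_swap_same hab.symm hpb.symm hpa.symm
  have hcl := Equiv.Perm.IsThreeCycle.alternating_normalClosure
    (by rwa [Nat.card_eq_fintype_card]) h3c
  have hle : (⊤ : Subgroup (alternatingGroup α)) ≤
      (ρ.comp (alternatingGroup α).subtype).ker := by
    rw [← hcl]
    apply Subgroup.normalClosure_le_normal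
    rw [Set.singleton_subset_iff]
    exact h3
  have hm : Equiv.swap x y * Equiv.swap a b ∈ alternatingGroup α := by
    rw [Equiv.Perm.mem_alternatingGroup, Equiv.Perm.sign_mul, Equiv.Perm.sign_swap hxy,
      Equiv.Perm.sign_swap hab]; rfl
  have h4 : ρ (Equiv.swap x y * Equiv.swap a b) = 1 :=
    hle (Subgroup.mem_top (⟨_, hm⟩ : alternatingGroup α))
  calc _ = ρ (Equiv.swap x y) * (ρ (Equiv.swap a b) * ρ (Equiv.swap a b)) := by
          rw [hsq, mul_one]
      _ = _ := by rw [← mul_assoc, ← map_mul, h4, one_mul]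

lemma mainTwist {α V : Type*} [Fintype α] [DecidableEq α] [AddCommGroup V] [Module ℂ V]
    [FiniteDimensional ℂ V] (ρ : Equiv.Perm α →* (V →ₗ[ℂ] V)) (hn : 5 ≤ Fintype.card α)
    (hd : finrank ℂ V + 2 ≤ Fintype.card α) (p q : α) (hpq : p ≠ q) (v : V) (hv : v ≠ 0)
    (δ : ℂ)
    (hs : ∀ a b, a ≠ b → a ≠ p → a ≠ q → b ≠ p → b ≠ q → ρ (Equiv.swap a b) v = δ • v)
    (ε : ℂ) (hε : ρ (Equiv.swap p q) v = ε • v) :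
    ∃ v : V, v ≠ 0 ∧ ∃ ε : ℂ, ∀ a b, a ≠ b → ρ (Equiv.swap a b) v = ε • v := by
  by_cases h1 : δ = 1
  · obtain ⟨w, hw, h⟩ := mainL ρ hn hd p q hpq v hv
      (by simpa only [h1, one_smul] using hs) ε hε
    exact ⟨w, hw, 1, fun a b _ => by rw [h, one_smul]⟩
  let ρ' : Equiv.Perm α →* (V →ₗ[ℂ] V) :=
    { toFun := fun σ => (((Equiv.Perm.sign σ : ℤ) : ℂ)) • ρ σ
      map_one' := by simp
      map_mul' := fun a b => by
        rw [map_mul, map_mul, smul_mul_smul_comm]; simp }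
  have hρ' : ∀ a b, a ≠ b → ∀ v, ρ' (Equiv.swap a b) v = - ρ (Equiv.swap a b) v := by
    intro a b hab v
    simp [ρ', Equiv.Perm.sign_swap hab]
  obtain ⟨w, hw, h⟩ := mainL ρ' hn hd p q hpq v hv (by
    intro a b hab h2 h3 h4 h5
    have hδ : (δ * δ - 1) • v = 0 := by
      have h6 : ρ (Equiv.swap a b) (ρ (Equiv.swap a b) v) = v := by
        rw [← Module.End.mul_apply, ← map_mul, Equiv.swap_mul_self, map_one]; rfl
      rw [hs a b hab h2 h3 h4 h5, map_smul, hs a b hab h2 h3 h4 h5, smul_smul] at h6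
      rw [sub_smul, h6, one_smul, sub_self]
    have h7 := (smul_eq_zero.1 hδ).resolve_right hv
    have h8 : (δ - 1) * (δ + 1) = 0 := by linear_combination h7
    have h9 := (mul_eq_zero.1 h8).resolve_left (sub_ne_zero.2 h1)
    rw [hρ' a b hab, hs a b hab h2 h3 h4 h5, eq_neg_of_add_eq_zero_left h9]
    simp) (-ε) (by rw [hρ' p q hpq, hε, neg_smul])
  refine ⟨w, hw, -1, fun a b hab => ?_⟩
  have := h (Equiv.swap a b)
  rw [hρ' a b hab] at this
  rw [neg_smul, one_smul]
  exact neg_eq_iff_eq_neg.1 this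

theorem smallRep (n : ℕ) : 3 ≤ n → n ≠ 4 → ∀ (α : Type) [Fintype α] [DecidableEq α],
    Fintype.card α = n → ∀ (V : Type*) [AddCommGroup V] [Module ℂ V] [FiniteDimensional ℂ V]
    (ρ : Equiv.Perm α →* (V →ₗ[ℂ] V)), 0 < finrank ℂ V → finrank ℂ V + 2 ≤ n →
    ∃ v : V, v ≠ 0 ∧ ∃ ε : ℂ, ∀ a b, a ≠ b → ρ (Equiv.swap a b) v = ε • v := by
  induction n using Nat.strong_induction_on with
  | _ n ih =>
  intro h3 h4 α _ _ hα V _ _ _ ρ hpos hd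
  by_cases hn3 : n = 3
  · exact dimOne ρ (by omega)
  have hn : 5 ≤ n := by omega
  obtain ⟨p, q, hpq⟩ := Fintype.exists_pair_of_one_lt_card (α := α) (by omega)
  have hss : ∀ v, ρ (Equiv.swap p q) (ρ (Equiv.swap p q) v) = v := by
    intro v
    rw [← Module.End.mul_apply, ← map_mul, Equiv.swap_mul_self, map_one]; rfl
  let E : ℂ → Submodule ℂ V := fun η => LinearMap.ker (ρ (Equiv.swap p q) - η • 1)
  have hE : ∀ η v, v ∈ E η ↔ ρ (Equiv.swap p q) v = η • v := by
    intro η v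
    simp [E, sub_eq_zero]
  let β := {x : α // x ≠ p ∧ x ≠ q}
  have hβ : Fintype.card β = n - 2 := by
    have : Fintype.card β = ((Finset.univ : Finset α) \ {p, q}).card := by
      rw [Fintype.card_subtype]
      congr 1
      ext x; simp
    rw [this, Finset.card_sdiff_of_subset (Finset.subset_univ _), Finset.card_pair hpq,
      Finset.card_univ, hα]
  have hsub : ∀ η, ∃ ρ' : Equiv.Perm β →* (E η →ₗ[ℂ] E η),
      ∀ g v, ((ρ' g v : E η) : V) = ρ (Equiv.Perm.ofSubtype g) v := by
    intro η
    refine exSub (ρ.comp Equiv.Perm.ofSubtype) (E η) ?_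
    intro g v hv
    rw [hE] at hv ⊢
    have hc : Equiv.Perm.ofSubtype g * Equiv.swap p q =
        Equiv.swap p q * Equiv.Perm.ofSubtype g := by
      rw [Equiv.mul_swap_eq_swap_mul, Equiv.Perm.ofSubtype_apply_of_not_mem g (by simp),
        Equiv.Perm.ofSubtype_apply_of_not_mem g (by simp)]
    rw [MonoidHom.comp_apply, ← Module.End.mul_apply, ← map_mul, ← hc, map_mul,
      Module.End.mul_apply, hv, map_smul]
  have hcompl : IsCompl (E 1) (E (-1)) := by
    constructor
    · rw [Submodule.disjoint_def]
      intro v h1 h2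
      rw [hE] at h1 h2
      rw [h1, one_smul, neg_smul, one_smul] at h2
      have h5 : (2 : ℂ) • v = 0 := by
        rw [two_smul]; nth_rewrite 1 [h2]; exact neg_add_cancel v
      exact (smul_eq_zero.1 h5).resolve_left two_ne_zero
    · rw [codisjoint_iff, eq_top_iff]
      intro v _
      rw [Submodule.mem_sup]
      refine ⟨(2⁻¹ : ℂ) • (v + ρ (Equiv.swap p q) v), ?_,
        (2⁻¹ : ℂ) • (v - ρ (Equiv.swap p q) v), ?_, ?_⟩
      · rw [hE]; simp only [map_smul, map_add, hss]; module
      · rw [hE]; simp only [map_smul, map_sub, hss]; module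
      · module
  have hfr := Submodule.finrank_add_eq_of_isCompl hcompl
  -- a degenerate eigenspace
  have hdeg : ∀ η, E η = ⊤ →
      ∃ v : V, v ≠ 0 ∧ ∃ ε : ℂ, ∀ a b, a ≠ b → ρ (Equiv.swap a b) v = ε • v := by
    intro η hη
    have : Nontrivial V := Module.nontrivial_of_finrank_pos hpos
    obtain ⟨v, hv⟩ := exists_ne (0 : V)
    exact ⟨v, hv, η, fun a b hab => conjEq ρ p q hpq η
      (fun v => (hE η v).1 (hη ▸ Submodule.mem_top)) a b hab v⟩
  by_cases hp1 : finrank ℂ (E 1) = 0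
  · have h0 := Submodule.finrank_eq_zero.1 hp1
    rw [h0] at hcompl
    exact hdeg _ (eq_top_of_bot_isCompl hcompl)
  by_cases hm1 : finrank ℂ (E (-1)) = 0
  · have h0 := Submodule.finrank_eq_zero.1 hm1
    rw [h0] at hcompl
    exact hdeg _ (eq_top_of_isCompl_bot hcompl)
  -- the inductive step
  have hstep : ∀ η, 0 < finrank ℂ (E η) → finrank ℂ (E η) + 4 ≤ n →
      (n ≠ 6 ∨ finrank ℂ (E η) = 1) →
      ∃ v : V, v ≠ 0 ∧ ∃ ε : ℂ, ∀ a b, a ≠ b → ρ (Equiv.swap a b) v = ε • v := by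
    intro η hp hle hor
    obtain ⟨ρ', hρ'⟩ := hsub η
    have hex : ∃ v : E η, v ≠ 0 ∧ ∃ ε : ℂ, ∀ a b, a ≠ b → ρ' (Equiv.swap a b) v = ε • v := by
      by_cases h1 : finrank ℂ (E η) = 1
      · exact dimOne ρ' h1
      · have h6 := hor.resolve_right h1
        exact ih (n - 2) (by omega) (by omega) (by omega) β hβ (E η) ρ' hp (by omega)
    obtain ⟨v, hv, δ, hδ⟩ := hex
    refine mainTwist ρ (by omega) (by omega) p q hpq v (by simpa using hv) δ ?_ η
      ((hE η v).1 v.2)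
    intro a b hab hap haq hbp hbq
    have h := congrArg Subtype.val (hδ ⟨a, hap, haq⟩ ⟨b, hbp, hbq⟩
      (fun h => hab (congrArg Subtype.val h)))
    rw [hρ', Equiv.Perm.ofSubtype_swap_eq] at h
    exact h
  by_cases h6 : n = 6 ∧ finrank ℂ (E 1) = 2 ∧ finrank ℂ (E (-1)) = 2
  · obtain ⟨h6, hd1, hd2⟩ := h6
    let e : Fin 4 ≃ β := Fintype.equivOfCardEq (by rw [hβ, h6]; rfl)
    have hk : ∀ η, finrank ℂ (E η) = 2 → ∀ v ∈ E η,
        ρ (Equiv.swap (e 0 : α) (e 1) * Equiv.swap (e 2 : α) (e 3)) v = v := by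
      intro η hη v hv
      obtain ⟨ρ', hρ'⟩ := hsub η
      have h := hρ' (Equiv.swap (e 0) (e 1) * Equiv.swap (e 2) (e 3)) ⟨v, hv⟩
      rw [klein hη e ρ', map_mul, Equiv.Perm.ofSubtype_swap_eq,
        Equiv.Perm.ofSubtype_swap_eq] at h
      exact h.symm
    have hK : ρ (Equiv.swap (e 0 : α) (e 1) * Equiv.swap (e 2 : α) (e 3)) = 1 := by
      ext v
      have hv : v ∈ E 1 ⊔ E (-1) := by rw [hcompl.sup_eq_top]; trivial
      obtain ⟨x, hx, y, hy, rfl⟩ := Submodule.mem_sup.1 hv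
      rw [map_add, hk 1 hd1 x hx, hk (-1) hd2 y hy]; rfl
    have hne : ∀ i j, i ≠ j → (e i : α) ≠ e j :=
      fun i j hij h => hij (e.injective (Subtype.ext h))
    have hall := allEq ρ (by omega) p (e 0) (e 1) (e 2) (e 3) (hne _ _ (by decide))
      (e 0).2.1.symm (e 1).2.1.symm (e 2).2.1.symm (e 3).2.1.symm
      (hne _ _ (by decide)) (hne _ _ (by decide)) hK
    have : Nontrivial (E 1) := Module.nontrivial_of_finrank_pos (R := ℂ) (by omega)
    obtain ⟨v, hv⟩ := exists_ne (0 : E 1)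
    refine ⟨v, by simpa using hv, 1, fun a b hab => ?_⟩
    rw [hall a b hab, ← hall p q hpq]
    exact (hE 1 v).1 v.2
  by_cases hlt : finrank ℂ (E 1) ≤ finrank ℂ (E (-1))
  · exact hstep 1 (by omega) (by omega) (by omega)
  · exact hstep (-1) (by omega) (by omega) (by omega)

lemma simple_scalar {G W : Type*} [Group G] [AddCommGroup W] [Module ℂ W]
    [Module (MonoidAlgebra ℂ G) W] [IsScalarTower ℂ (MonoidAlgebra ℂ G) W]
    [IsSimpleModule (MonoidAlgebra ℂ G) W] (v : W) (hv : v ≠ 0)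
    (h : ∀ g : G, ∃ c : ℂ, MonoidAlgebra.of ℂ G g • v = c • v) : finrank ℂ W ≤ 1 := by
  refine finrank_le_one v fun w => ?_
  obtain ⟨a, rfl⟩ := IsSimpleModule.toSpanSingleton_surjective (MonoidAlgebra ℂ G) hv w
  rw [LinearMap.toSpanSingleton_apply]
  induction a using MonoidAlgebra.induction_on with
  | of g => obtain ⟨c, hc⟩ := h g; exact ⟨c, hc.symm⟩
  | add x y hx hy =>
    obtain ⟨c, hc⟩ := hx
    obtain ⟨d, hd⟩ := hy
    exact ⟨c + d, by rw [add_smul, add_smul, hc, hd]⟩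
  | smul r x hx =>
    obtain ⟨c, hc⟩ := hx
    exact ⟨r * c, by rw [mul_smul, hc, smul_assoc]⟩

lemma simple_dim (m : ℕ) (hm : m ≤ 1 ∨ 5 ≤ m) (W : Type*) [AddCommGroup W] [Module ℂ W]
    [Module (MonoidAlgebra ℂ (Equiv.Perm (Fin m))) W]
    [IsScalarTower ℂ (MonoidAlgebra ℂ (Equiv.Perm (Fin m))) W]
    [IsSimpleModule (MonoidAlgebra ℂ (Equiv.Perm (Fin m))) W]
    [FiniteDimensional ℂ W] : finrank ℂ W = 1 ∨ (5 ≤ m ∧ m - 1 ≤ finrank ℂ W) := by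
  have hnt : Nontrivial W := IsSimpleModule.nontrivial (MonoidAlgebra ℂ (Equiv.Perm (Fin m))) W
  have hpos : 0 < finrank ℂ W := Module.finrank_pos
  by_cases hbig : 5 ≤ m ∧ m - 1 ≤ finrank ℂ W
  · exact Or.inr hbig
  left
  have : SMulCommClass (MonoidAlgebra ℂ (Equiv.Perm (Fin m))) ℂ W :=
    SMulCommClass.symm _ _ _
  let ρ : Equiv.Perm (Fin m) →* (W →ₗ[ℂ] W) :=
    ((Algebra.lsmul ℂ ℂ W : MonoidAlgebra ℂ (Equiv.Perm (Fin m)) →ₐ[ℂ] Module.End ℂ W) :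
      MonoidAlgebra ℂ (Equiv.Perm (Fin m)) →* Module.End ℂ W).comp (MonoidAlgebra.of ℂ _)
  have hρ : ∀ g v, ρ g v = MonoidAlgebra.of ℂ _ g • v := fun g v => rfl
  have hex : ∃ v : W, v ≠ 0 ∧ ∃ ε : ℂ, ∀ a b, a ≠ b → ρ (Equiv.swap a b) v = ε • v := by
    rcases hm with hm | hm
    · obtain ⟨v, hv⟩ := exists_ne (0 : W)
      have : Subsingleton (Fin m) := Fin.subsingleton_iff_le_one.2 hm
      exact ⟨v, hv, 1, fun a b hab => absurd (Subsingleton.elim a b) hab⟩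
    · exact smallRep m (by omega) (by omega) (Fin m) (by simp) W ρ hpos (by omega)
  obtain ⟨v, hv, ε, hε⟩ := hex
  have hle := simple_scalar (G := Equiv.Perm (Fin m)) v hv (by
    intro g
    rw [← hρ]
    induction g using Equiv.Perm.swap_induction_on with
    | one => exact ⟨1, by simp⟩
    | swap_mul f x y hxy ih =>
      obtain ⟨c, hc⟩ := ih
      exact ⟨c * ε, by rw [map_mul, Module.End.mul_apply, hc, map_smul, hε x y hxy, smul_smul]⟩)
  omega

lemma le_choose_mid (n : ℕ) : ∀ a, 0 < a → a < n → n ≤ n.choose a := by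
  induction n with
  | zero => intro a _ h; omega
  | succ n ih =>
    intro a h1 h2
    obtain ⟨a, rfl⟩ := Nat.exists_eq_succ_of_ne_zero h1.ne'
    rw [Nat.succ_eq_add_one, Nat.choose_succ_succ]
    by_cases h : a + 1 = n
    · subst h; simp
    · have h3 := ih (a + 1) (by omega) (by omega)
      have h4 : 0 < n.choose a := Nat.choose_pos (by omega)
      simp only [Nat.succ_eq_add_one]
      omega

/-- For `n ≥ 5`, if `(λ,μ)` is a bipartition of `n` (with `|λ| = a`,
`|μ| = b`, `a + b = n`) and the corresponding simple `ℂ[B_n]`-module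
`S^{(λ,μ)}` — whose dimension equals `binomial(n,a) · f^λ · f^μ`, where `f^λ = dim S^λ` and
`f^μ = dim S^μ` are the dimensions of the Specht modules, i.e. of simple modules of the
symmetric groups `S_a` and `S_b` — has dimension different from `1`, then its dimension is at
least `n − 1`. -/
theorem stmt13 (n a b : ℕ) (hn : 5 ≤ n) (hab : a + b = n)
    (W₁ : Type*) [AddCommGroup W₁] [Module ℂ W₁]
    [Module (MonoidAlgebra ℂ (Equiv.Perm (Fin a))) W₁]
    [IsScalarTower ℂ (MonoidAlgebra ℂ (Equiv.Perm (Fin a))) W₁]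
    [IsSimpleModule (MonoidAlgebra ℂ (Equiv.Perm (Fin a))) W₁]
    [FiniteDimensional ℂ W₁]
    (W₂ : Type*) [AddCommGroup W₂] [Module ℂ W₂]
    [Module (MonoidAlgebra ℂ (Equiv.Perm (Fin b))) W₂]
    [IsScalarTower ℂ (MonoidAlgebra ℂ (Equiv.Perm (Fin b))) W₂]
    [IsSimpleModule (MonoidAlgebra ℂ (Equiv.Perm (Fin b))) W₂]
    [FiniteDimensional ℂ W₂]
    (hdim : n.choose a * finrank ℂ W₁ * finrank ℂ W₂ ≠ 1) :
    n - 1 ≤ n.choose a * finrank ℂ W₁ * finrank ℂ W₂ := by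
  have hnt1 : Nontrivial W₁ :=
    IsSimpleModule.nontrivial (MonoidAlgebra ℂ (Equiv.Perm (Fin a))) W₁
  have hnt2 : Nontrivial W₂ :=
    IsSimpleModule.nontrivial (MonoidAlgebra ℂ (Equiv.Perm (Fin b))) W₂
  have hp1 : 0 < finrank ℂ W₁ := Module.finrank_pos
  have hp2 : 0 < finrank ℂ W₂ := Module.finrank_pos
  by_cases ha : a = 0
  · have hc : n.choose a = 1 := by rw [ha, Nat.choose_zero_right]
    have h1 := simple_dim a (by omega) W₁
    have h1' : finrank ℂ W₁ = 1 := by omega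
    have h2 := simple_dim b (by omega) W₂
    rw [hc, h1', one_mul, one_mul] at hdim ⊢
    omega
  by_cases hb : b = 0
  · have hc : n.choose a = 1 := by
      have : a = n := by omega
      rw [this, Nat.choose_self]
    have h1 := simple_dim b (by omega) W₂
    have h1' : finrank ℂ W₂ = 1 := by omega
    have h2 := simple_dim a (by omega) W₁
    rw [hc, h1', one_mul, mul_one] at hdim ⊢
    omega
  have hc := le_choose_mid n a (by omega) (by omega)
  calc n - 1 ≤ n.choose a := by omega
    _ ≤ n.choose a * finrank ℂ W₁ := Nat.le_mul_of_pos_right _ hp1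
    _ ≤ _ := Nat.le_mul_of_pos_right _ hp2
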